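/- arXiv:0708.2636 — 2 statements merged into one kernel-verified Lean document; each statement's English description precedes it below -/
import Mathlib

section
/- Assume E/F is biquadratic. If E₀/F is unramified and |k_F| ≡ 3 (mod 4), then the quadratic form q(x) = h(x, βx) on V is anisotropic if and only if β δ₀ ∉ F^× · (E₀^×)²; in all other cases (E₀/F ramified, or E₀/F unramified with |k_F| ≡ 1 (mod 4)), q is anisotropic if and only if β δ₀ ∈ F^× · (E₀^×)². (Remark at the end of §3.2.) -/
/-- Encoding of a nonarchimedean local field via a (normalized, surjective)
additive valuation `ν : K → ℤ` with junk value at `0`:  `ν` is additive on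
products and ultrametric on nonzero elements, `ν(K^×) = ℤ`, the field is
complete (every `ν`-Cauchy sequence converges), and the residue field is
finite (finitely many residue classes of integers). -/
structure IsNALocalField {K : Type*} [Field K] (ν : K → ℤ) : Prop where
  map_mul : ∀ x y : K, x ≠ 0 → y ≠ 0 → ν (x * y) = ν x + ν y
  ultrametric : ∀ x y : K, x ≠ 0 → y ≠ 0 → x + y ≠ 0 → min (ν x) (ν y) ≤ ν (x + y)
  surj : ∀ n : ℤ, ∃ x : K, x ≠ 0 ∧ ν x = n
  complete : ∀ a : ℕ → K,
    (∀ N : ℤ, ∃ M : ℕ, ∀ m ≥ M, ∀ n ≥ M, a m = a n ∨ N ≤ ν (a m - a n)) →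
    ∃ L : K, ∀ N : ℤ, ∃ M : ℕ, ∀ m ≥ M, a m = L ∨ N ≤ ν (a m - L)
  finiteResidue : ∃ S : Finset K, ∀ x : K, (x = 0 ∨ 0 ≤ ν x) →
    ∃ y ∈ S, x = y ∨ 0 < ν (x - y)

/-- Odd residual characteristic: `2` is a unit of the valuation ring
(equivalently, the characteristic of the residue field is odd). -/
def OddResidualChar {K : Type*} [Field K] (ν : K → ℤ) : Prop :=
  (2 : K) ≠ 0 ∧ ν (2 : K) = 0

/-- `E/F` is biquadratic: Galois with group `ℤ/2ℤ × ℤ/2ℤ`. -/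
def IsBiquadratic (F E : Type*) [Field F] [Field E] [Algebra F E] : Prop :=
  IsGalois F E ∧ Nonempty ((E ≃ₐ[F] E) ≃* Multiplicative (ZMod 2 × ZMod 2))

namespace IsNALocalField

/-- The valuation of `x` is at least `N`, where `0` has infinite valuation. -/
def ValGE {K : Type*} [Field K] (ν : K → ℤ) (N : ℤ) (x : K) : Prop :=
  x = 0 ∨ N ≤ ν x

variable {K : Type*} [Field K] {ν : K → ℤ}

theorem map_one (h : IsNALocalField ν) : ν 1 = 0 := by
  have := h.map_mul 1 1 one_ne_zero one_ne_zero
  rw [mul_one] at this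
  omega

theorem map_neg (h : IsNALocalField ν) (x : K) : ν (-x) = ν x := by
  rcases eq_or_ne x 0 with rfl | hx
  · simp
  have h1 : (-1 : K) ≠ 0 := by simp
  have h2 := h.map_mul (-1) (-1) h1 h1
  rw [neg_mul_neg, mul_one, h.map_one] at h2
  have h3 := h.map_mul (-1) x h1 hx
  rw [neg_one_mul] at h3
  omega

theorem map_sq (h : IsNALocalField ν) {x : K} (hx : x ≠ 0) : ν (x ^ 2) = 2 * ν x := by
  rw [pow_two, h.map_mul x x hx hx]
  ring

theorem map_inv (h : IsNALocalField ν) {x : K} (hx : x ≠ 0) : ν x⁻¹ = -ν x := by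
  have := h.map_mul x x⁻¹ hx (inv_ne_zero hx)
  rw [mul_inv_cancel₀ hx, h.map_one] at this
  omega

theorem map_div (h : IsNALocalField ν) {x y : K} (hx : x ≠ 0) (hy : y ≠ 0) :
    ν (x / y) = ν x - ν y := by
  rw [div_eq_mul_inv, h.map_mul x y⁻¹ hx (inv_ne_zero hy), h.map_inv hy]
  ring

theorem ValGE.add (h : IsNALocalField ν) {N : ℤ} {x y : K} (hx : ValGE ν N x)
    (hy : ValGE ν N y) : ValGE ν N (x + y) := by
  rcases eq_or_ne x 0 with rfl | hx0
  · simpa using hy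
  rcases eq_or_ne y 0 with rfl | hy0
  · simpa using hx
  rcases eq_or_ne (x + y) 0 with h0 | h0
  · exact Or.inl h0
  have h1 := h.ultrametric x y hx0 hy0 h0
  have h2 := hx.resolve_left hx0
  have h3 := hy.resolve_left hy0
  right
  omega

theorem ValGE.neg (h : IsNALocalField ν) {N : ℤ} {x : K} (hx : ValGE ν N x) :
    ValGE ν N (-x) := by
  rcases hx with rfl | hx
  · left; simp
  · right; rwa [h.map_neg]

theorem ValGE.sub (h : IsNALocalField ν) {N : ℤ} {x y : K} (hx : ValGE ν N x)
    (hy : ValGE ν N y) : ValGE ν N (x - y) := by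
  rw [sub_eq_add_neg]
  exact hx.add h (hy.neg h)

theorem ValGE.mul (h : IsNALocalField ν) {M N : ℤ} {x y : K} (hx : ValGE ν M x)
    (hy : ValGE ν N y) : ValGE ν (M + N) (x * y) := by
  rcases eq_or_ne x 0 with rfl | hx0
  · left; simp
  rcases eq_or_ne y 0 with rfl | hy0
  · left; simp
  right
  rw [h.map_mul x y hx0 hy0]
  exact add_le_add (hx.resolve_left hx0) (hy.resolve_left hy0)

theorem ValGE.mono {M N : ℤ} {x : K} (hx : ValGE ν N x) (hMN : M ≤ N) : ValGE ν M x :=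
  hx.imp_right hMN.trans

theorem valGE_one (h : IsNALocalField ν) : ValGE ν 0 1 :=
  Or.inr h.map_one.ge

theorem valGE_half (h : IsNALocalField ν) (h2 : OddResidualChar ν) : ValGE ν 0 (2⁻¹ : K) := by
  right
  rw [h.map_inv h2.1, h2.2, neg_zero]

theorem eq_zero_of_forall_valGE {x : K} (hx : ∀ N : ℕ, ValGE ν N x) : x = 0 := by
  by_contra h0
  have := (hx (ν x + 1).toNat).resolve_left h0
  omega

theorem add_ne_zero_of_lt (h : IsNALocalField ν) {x y : K} (hxy : ν x < ν y) : x + y ≠ 0 := by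
  intro h0
  rw [eq_neg_of_add_eq_zero_left h0, h.map_neg] at hxy
  exact lt_irrefl _ hxy

theorem map_add_of_lt (h : IsNALocalField ν) {x y : K} (hx : x ≠ 0) (hy : y ≠ 0)
    (hxy : ν x < ν y) : ν (x + y) = ν x := by
  have h0 := h.add_ne_zero_of_lt hxy
  have h1 := h.ultrametric x y hx hy h0
  have h2 := h.ultrametric (x + y) (-y) h0 (neg_ne_zero.2 hy) (by simpa using hx)
  rw [add_neg_cancel_right, h.map_neg] at h2
  omega

/-- The Newton-type iteration converging to a square root of `x`. -/
def sqrtSeq (x : K) : ℕ → K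
  | 0 => 1
  | n + 1 => sqrtSeq x n - (sqrtSeq x n ^ 2 - x) * 2⁻¹

theorem sqrtSeq_spec (h : IsNALocalField ν) (h2 : OddResidualChar ν) {x : K}
    (hx : ValGE ν 1 (x - 1)) (n : ℕ) :
    ValGE ν 1 (sqrtSeq x n - 1) ∧ ValGE ν (n + 1) (sqrtSeq x n ^ 2 - x) := by
  have half := h.valGE_half h2
  have h20 := h2.1
  induction n with
  | zero =>
    refine ⟨Or.inl (by simp [sqrtSeq]), ?_⟩
    have := hx.neg h
    simpa [sqrtSeq] using this
  | succ n ih =>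
    obtain ⟨h1, h3⟩ := ih
    constructor
    · have := h1.sub h ((h3.mul h half).mono (by omega : (1 : ℤ) ≤ n + 1 + 0))
      convert this using 1
      simp only [sqrtSeq]
      ring
    · have e1 := ((h1.mul h h3).neg h).mono (by push_cast; omega :
        ((n + 1 : ℕ) : ℤ) + 1 ≤ 1 + (n + 1))
      have e2 := ((h3.mul h half).mul h (h3.mul h half)).mono (by push_cast; omega :
        ((n + 1 : ℕ) : ℤ) + 1 ≤ (n + 1 + 0) + (n + 1 + 0))
      convert e1.add h e2 using 1
      simp only [sqrtSeq]
      field_simp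
      ring

theorem sqrtSeq_sub (h : IsNALocalField ν) (h2 : OddResidualChar ν) {x : K}
    (hx : ValGE ν 1 (x - 1)) (n k : ℕ) :
    ValGE ν n (sqrtSeq x (n + k) - sqrtSeq x n) := by
  induction k with
  | zero => left; simp
  | succ k ih =>
    have h1 := (((h.sqrtSeq_spec h2 hx (n + k)).2.mul h (h.valGE_half h2)).neg h).mono
      (by push_cast; omega : (n : ℤ) ≤ ((n + k : ℕ) : ℤ) + 1 + 0)
    convert ih.add h h1 using 1
    rw [← add_assoc]
    simp only [sqrtSeq]
    ring

/-- Hensel's lemma for square roots of principal units. -/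
theorem isSquare_of_valGE_one (h : IsNALocalField ν) (h2 : OddResidualChar ν) {x : K}
    (hx : ValGE ν 1 (x - 1)) : IsSquare x := by
  obtain ⟨L, hL⟩ := h.complete (sqrtSeq x) (by
    intro N
    refine ⟨N.toNat, fun m hm n hn => ?_⟩
    obtain ⟨k, rfl⟩ := Nat.exists_eq_add_of_le hm
    obtain ⟨l, rfl⟩ := Nat.exists_eq_add_of_le hn
    have := ((h.sqrtSeq_sub h2 hx N.toNat k).sub h (h.sqrtSeq_sub h2 hx N.toNat l)).mono
      (Int.self_le_toNat N)
    rw [sub_sub_sub_cancel_right] at this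
    exact this.imp_left sub_eq_zero.1)
  refine ⟨L, ?_⟩
  rw [← pow_two, eq_comm, ← sub_eq_zero]
  refine eq_zero_of_forall_valGE (ν := ν) fun N => ?_
  obtain ⟨M, hM⟩ := hL N
  set n := max M N
  have h3 : ValGE ν N (sqrtSeq x n - L) := (hM n (le_max_left _ _)).imp_left sub_eq_zero.2
  obtain ⟨h4, h5⟩ := h.sqrtSeq_spec h2 hx n
  have h6 : ValGE ν 0 (sqrtSeq x n) := by
    convert (h4.mono (by omega : (0 : ℤ) ≤ 1)).add h h.valGE_one using 1
    ring
  have h7 : ValGE ν 0 (sqrtSeq x n + L) := by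
    convert (h6.add h h6).sub h (h3.mono (by omega : (0 : ℤ) ≤ N)) using 1
    ring
  have hn : (N : ℤ) ≤ n := by exact_mod_cast le_max_right M N
  convert (h5.mono (by omega)).sub h ((h3.mul h h7).mono (by omega : (N : ℤ) ≤ N + 0)) using 1
  ring

/-- Adding a term of larger valuation does not change the square class. -/
theorem isSquare_mul_add_of_lt (h : IsNALocalField ν) (h2 : OddResidualChar ν) {x y : K}
    (hx : x ≠ 0) (hxy : ValGE ν (ν x + 1) y) : ∃ s : K, x + y = x * s ^ 2 := by
  have : ValGE ν 1 ((1 + y / x) - 1) := by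
    rw [add_sub_cancel_left]
    rcases eq_or_ne y 0 with rfl | hy
    · left; simp
    right
    rw [h.map_div hy hx]
    have := hxy.resolve_left hy
    omega
  obtain ⟨s, hs⟩ := h.isSquare_of_valGE_one h2 this
  refine ⟨s, ?_⟩
  rw [pow_two, ← hs]
  field_simp

/-- The valuation ring of `ν`. -/
def valuationRing (h : IsNALocalField ν) : ValuationSubring K where
  carrier := {x | ValGE ν 0 x}
  mul_mem' := by
    intro x y hx hy
    simpa using ValGE.mul h hx hy
  one_mem' := h.valGE_one
  add_mem' :=
    fun hx hy => ValGE.add h hx hy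
  zero_mem' := Or.inl rfl
  neg_mem' := fun hx => ValGE.neg h hx
  mem_or_inv_mem' x := by
    rcases eq_or_ne x 0 with rfl | hx
    · left; left; rfl
    rcases le_total 0 (ν x) with h0 | h0
    · left; right; exact h0
    · right; right; rw [h.map_inv hx]; omega

theorem mem_valuationRing (h : IsNALocalField ν) {x : K} : x ∈ h.valuationRing ↔ ValGE ν 0 x := Iff.rfl

theorem residue_eq_zero_iff (h : IsNALocalField ν) (x : h.valuationRing) :
    IsLocalRing.residue h.valuationRing x = 0 ↔ ValGE ν 1 (x : K) := by
  rw [IsLocalRing.residue_eq_zero_iff, IsLocalRing.mem_maximalIdeal, mem_nonunits_iff]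
  constructor
  · intro hu
    by_contra hx
    obtain ⟨hx0, hx1⟩ := not_or.1 hx
    refine hu ?_
    have hinv : (x : K)⁻¹ ∈ h.valuationRing := by
      right
      rw [h.map_inv hx0]
      omega
    exact IsUnit.of_mul_eq_one ⟨_, hinv⟩ (Subtype.ext (mul_inv_cancel₀ hx0))
  · rintro hx hu
    obtain ⟨y, hy⟩ := hu.exists_right_inv
    have h1 : ValGE ν (1 + 0) ((x : K) * y) := hx.mul h y.2
    have h3 : (x : K) * y = 1 := congrArg Subtype.val hy
    rw [h3] at h1
    have := h1.resolve_left one_ne_zero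
    rw [h.map_one] at this
    omega

theorem residue_eq_iff (h : IsNALocalField ν) (x y : h.valuationRing) :
    IsLocalRing.residue h.valuationRing x = IsLocalRing.residue h.valuationRing y ↔ ValGE ν 1 ((x : K) - y) := by
  rw [← sub_eq_zero, ← _root_.map_sub, h.residue_eq_zero_iff]
  rfl

theorem finite_residueField (h : IsNALocalField ν) :
    Finite (IsLocalRing.ResidueField h.valuationRing) := by
  classical
  obtain ⟨S, hS⟩ := h.finiteResidue
  let f : S → IsLocalRing.ResidueField h.valuationRing := fun y =>
    if hy : (y : K) ∈ h.valuationRing then IsLocalRing.residue h.valuationRing ⟨y, hy⟩ else 0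
  refine Finite.of_surjective f fun z => ?_
  obtain ⟨x, rfl⟩ := IsLocalRing.residue_surjective z
  obtain ⟨y, hyS, hy⟩ := hS x x.2
  have hxy : ValGE ν 1 ((x : K) - y) := hy.imp sub_eq_zero.2 (by omega)
  have hyr : y ∈ h.valuationRing := by
    have := (h.mem_valuationRing.1 x.2).sub h (hxy.mono zero_le_one)
    rwa [sub_sub_cancel] at this
  refine ⟨⟨y, hyS⟩, ?_⟩
  simp only [f, hyr, dif_pos]
  rw [eq_comm, h.residue_eq_iff]
  exact hxy

/-- A unit whose residue is a square is a square. -/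
theorem isSquare_of_residue (h : IsNALocalField ν) (h2 : OddResidualChar ν) (x : h.valuationRing)
    (hx0 : (x : K) ≠ 0) (hx : ν (x : K) = 0)
    (hs : IsSquare (IsLocalRing.residue h.valuationRing x)) : IsSquare (x : K) := by
  obtain ⟨r, hr⟩ := hs
  obtain ⟨z, rfl⟩ := IsLocalRing.residue_surjective r
  rw [← _root_.map_mul, h.residue_eq_iff] at hr
  have h1 : ValGE ν (ν (x : K) + 1) (-((x : K) - (z * z : h.valuationRing))) := by
    rw [hx]
    exact hr.neg h
  obtain ⟨s, hs⟩ := h.isSquare_mul_add_of_lt h2 hx0 h1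
  have h3 : (x : K) + -((x : K) - (z * z : h.valuationRing)) = z * z := by
    push_cast
    ring
  rw [h3] at hs
  have hs0 : s ≠ 0 := by
    rintro rfl
    have hz : (z : K) = 0 := by simpa using hs
    have h4 : ValGE ν 1 (x : K) := by simpa [hz] using hr
    have := h4.resolve_left hx0
    omega
  refine ⟨z / s, ?_⟩
  rw [div_mul_div_comm, hs]
  field_simp

/-- Nonsquares of even valuation form a single square class. -/
theorem isSquare_mul_of_even (h : IsNALocalField ν) (h2 : OddResidualChar ν) {x y : K}
    (hx0 : x ≠ 0) (hy0 : y ≠ 0) (hxe : Even (ν x)) (hye : Even (ν y))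
    (hx : ¬IsSquare x) (hy : ¬IsSquare y) : IsSquare (x * y) := by
  have normalize : ∀ x : K, x ≠ 0 → Even (ν x) →
      ∃ t : K, t ≠ 0 ∧ ∃ u : h.valuationRing, (u : K) ≠ 0 ∧ ν (u : K) = 0 ∧ x = u * t ^ 2 := by
    rintro x hx ⟨k, hk⟩
    obtain ⟨t, ht0, ht⟩ := h.surj k
    have hu : ν (x / t ^ 2) = 0 := by
      rw [h.map_div hx (pow_ne_zero 2 ht0), h.map_sq ht0]
      omega
    exact ⟨t, ht0, ⟨x / t ^ 2, Or.inr hu.ge⟩, div_ne_zero hx (pow_ne_zero 2 ht0), hu,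
      by field_simp⟩
  have nonsquare : ∀ (t : K) (u : h.valuationRing), ¬IsSquare ((u : K) * t ^ 2) →
      (u : K) ≠ 0 → ν (u : K) = 0 → ¬IsSquare (IsLocalRing.residue h.valuationRing u) :=
    fun t u hn hu0 hu hs => hn ((h.isSquare_of_residue h2 u hu0 hu hs).mul (IsSquare.sq t))
  obtain ⟨s, hs0, u, hu0, hu, rfl⟩ := normalize x hx0 hxe
  obtain ⟨t, ht0, v, hv0, hv, rfl⟩ := normalize y hy0 hye
  have hru := nonsquare s u hx hu0 hu
  have hrv := nonsquare t v hy hv0 hv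
  have : Finite (IsLocalRing.ResidueField h.valuationRing) := h.finite_residueField
  have := Fintype.ofFinite (IsLocalRing.ResidueField h.valuationRing)
  have huv : IsSquare (IsLocalRing.residue h.valuationRing (u * v)) := by
    classical
    have hne : IsLocalRing.residue h.valuationRing (u * v) ≠ 0 := by
      rw [_root_.map_mul]
      refine mul_ne_zero ?_ ?_ <;> rintro h0
      · exact hru (h0 ▸ IsSquare.zero)
      · exact hrv (h0 ▸ IsSquare.zero)
    rw [← quadraticChar_one_iff_isSquare hne, _root_.map_mul, _root_.map_mul,
      quadraticChar_neg_one_iff_not_isSquare.2 hru, quadraticChar_neg_one_iff_not_isSquare.2 hrv]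
    norm_num
  have h3 : IsSquare ((u * v : h.valuationRing) : K) := by
    refine h.isSquare_of_residue h2 _ ?_ ?_ huv
    · exact mul_ne_zero hu0 hv0
    · push_cast
      rw [h.map_mul _ _ hu0 hv0, hu, hv, add_zero]
  have key : (u : K) * s ^ 2 * (v * t ^ 2) = (u * v : h.valuationRing) * (s * t) ^ 2 := by
    push_cast
    ring
  rw [key]
  exact h3.mul (IsSquare.sq (s * t))

/-- Norms from the unramified quadratic extension have the smallest possible valuation. -/
theorem map_sq_sub_of_even (h : IsNALocalField ν) (h2 : OddResidualChar ν) {d A B : K}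
    (hd : ¬IsSquare d) (hA : A ≠ 0) (hB : B ≠ 0) (hAB : 2 * ν A = ν d + 2 * ν B) :
    ν (A ^ 2 - d * B ^ 2) = 2 * ν A := by
  have hd0 : d ≠ 0 := by rintro rfl; exact hd IsSquare.zero
  have hA2 := pow_ne_zero 2 hA
  have hdB : d * B ^ 2 ≠ 0 := mul_ne_zero hd0 (pow_ne_zero 2 hB)
  have hνd : ν (d * B ^ 2) = 2 * ν A := by
    rw [h.map_mul _ _ hd0 (pow_ne_zero 2 hB), h.map_sq hB, hAB]
  by_contra hne
  have h1 : ValGE ν (2 * ν A) (A ^ 2 - d * B ^ 2) :=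
    ValGE.sub h (Or.inr (h.map_sq hA).ge) (Or.inr hνd.ge)
  have h3 : ValGE ν (ν (A ^ 2) + 1) (-(A ^ 2 - d * B ^ 2)) := by
    rw [h.map_sq hA]
    exact ValGE.neg h (h1.imp_right fun h4 => by omega)
  obtain ⟨s, hs⟩ := h.isSquare_mul_add_of_lt h2 hA2 h3
  refine hd ⟨A * s / B, ?_⟩
  have : d * B ^ 2 = A ^ 2 * s ^ 2 := by rw [← hs]; ring
  field_simp
  rw [this]

theorem map_sub_of_lt (h : IsNALocalField ν) {x y : K} (hx : x ≠ 0) (hy : y ≠ 0)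
    (hxy : ν x < ν y) : ν (x - y) = ν x := by
  rw [sub_eq_add_neg]
  exact h.map_add_of_lt hx (neg_ne_zero.2 hy) (by rwa [h.map_neg])

theorem even_map_sq_sub (h : IsNALocalField ν) (h2 : OddResidualChar ν) {d A B : K}
    (hd : ¬IsSquare d) (hde : Even (ν d)) (hn : A ^ 2 - d * B ^ 2 ≠ 0) :
    Even (ν (A ^ 2 - d * B ^ 2)) := by
  have hd0 : d ≠ 0 := by rintro rfl; exact hd IsSquare.zero
  rcases eq_or_ne B 0 with rfl | hB
  · have hA : A ≠ 0 := by rintro rfl; simp at hn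
    simp [h.map_sq hA]
  have hdB : d * B ^ 2 ≠ 0 := mul_ne_zero hd0 (pow_ne_zero 2 hB)
  have hνd : ν (d * B ^ 2) = ν d + 2 * ν B := by
    rw [h.map_mul _ _ hd0 (pow_ne_zero 2 hB), h.map_sq hB]
  have hde' : Even (ν (d * B ^ 2)) := by rw [hνd]; exact hde.add (even_two_mul _)
  rcases eq_or_ne A 0 with rfl | hA
  · simpa [h.map_neg] using hde'
  have hνA := h.map_sq hA
  rcases lt_trichotomy (ν (A ^ 2)) (ν (d * B ^ 2)) with hlt | heq | hlt
  · rw [h.map_sub_of_lt (pow_ne_zero 2 hA) hdB hlt, hνA]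
    exact even_two_mul _
  · rw [h.map_sq_sub_of_even h2 hd hA hB (by omega)]
    exact even_two_mul _
  · rw [← h.map_neg, neg_sub, h.map_sub_of_lt hdB (pow_ne_zero 2 hA) hlt]
    exact hde'

/-- Norms of even valuation from a ramified quadratic extension are squares. -/
theorem isSquare_sq_sub (h : IsNALocalField ν) (h2 : OddResidualChar ν) {d A B : K}
    (hd0 : d ≠ 0) (hde : ¬Even (ν d)) (hn : Even (ν (A ^ 2 - d * B ^ 2))) :
    IsSquare (A ^ 2 - d * B ^ 2) := by
  rcases eq_or_ne B 0 with rfl | hB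
  · simpa using IsSquare.sq A
  have hdB : d * B ^ 2 ≠ 0 := mul_ne_zero hd0 (pow_ne_zero 2 hB)
  have hνd : ν (d * B ^ 2) = ν d + 2 * ν B := by
    rw [h.map_mul _ _ hd0 (pow_ne_zero 2 hB), h.map_sq hB]
  have hde' : ¬Even (ν (d * B ^ 2)) := by simpa [hνd, Int.even_add] using hde
  rcases eq_or_ne A 0 with rfl | hA
  · refine absurd hn ?_
    simpa [h.map_neg] using hde'
  have hνA := h.map_sq hA
  rcases lt_trichotomy (ν (A ^ 2)) (ν (d * B ^ 2)) with hlt | heq | hlt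
  · have h3 : ValGE ν (ν (A ^ 2) + 1) (-(d * B ^ 2)) := Or.inr (by rw [h.map_neg]; omega)
    obtain ⟨s, hs⟩ := h.isSquare_mul_add_of_lt h2 (pow_ne_zero 2 hA) h3
    exact ⟨A * s, by rw [sub_eq_add_neg, hs]; ring⟩
  · refine absurd ?_ hde'
    rw [← heq, hνA]
    exact even_two_mul _
  · refine absurd hn ?_
    rwa [← h.map_neg, neg_sub, h.map_sub_of_lt hdB (pow_ne_zero 2 hA) hlt]

/-- An element that is a norm from all three quadratic subextensions of a biquadratic extension
is a square. -/
theorem isSquare_of_forall_norm (h : IsNALocalField ν) (h2 : OddResidualChar ν) {d a n : K}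
    (hd : ¬IsSquare d) (ha : ¬IsSquare a) (hda : ¬IsSquare (d * a)) (hn0 : n ≠ 0)
    (hnd : ∃ A B, n = A ^ 2 - d * B ^ 2) (hna : ∃ A B, n = A ^ 2 - a * B ^ 2)
    (hnda : ∃ A B, n = A ^ 2 - d * a * B ^ 2) : IsSquare n := by
  have ne0 : ∀ x : K, ¬IsSquare x → x ≠ 0 := by rintro x hx rfl; exact hx IsSquare.zero
  have aux : ∀ e p : K, ¬IsSquare e → p ≠ 0 → Even (ν e) → ¬Even (ν p) →
      (∃ A B, n = A ^ 2 - e * B ^ 2) → (∃ A B, n = A ^ 2 - p * B ^ 2) → IsSquare n := by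
    rintro e p he hp hee hpo ⟨A, B, hAB⟩ ⟨C, D, hCD⟩
    have hne : Even (ν n) := hAB ▸ h.even_map_sq_sub h2 he hee (hAB ▸ hn0)
    exact hCD ▸ h.isSquare_sq_sub h2 hp hpo (hCD ▸ hne)
  have hνda := h.map_mul d a (ne0 d hd) (ne0 a ha)
  by_cases hde : Even (ν d) <;> by_cases hae : Even (ν a)
  · exact absurd (h.isSquare_mul_of_even h2 (ne0 d hd) (ne0 a ha) hde hae hd ha) hda
  · exact aux d a hd (ne0 a ha) hde hae hnd hna
  · exact aux a d ha (ne0 d hd) hae hde hna hnd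
  · exact aux (d * a) d hda (ne0 d hd) (by rw [hνda]; exact (Int.even_add.2 (by simp [hde, hae])))
      hde hnda hnd

/-- The norm group of a quadratic extension, modulo squares, has order at most two. -/
theorem isSquare_mul_of_norm (h : IsNALocalField ν) (h2 : OddResidualChar ν) {d A B C D : K}
    (hd : ¬IsSquare d) (hm : ¬IsSquare (A ^ 2 - d * B ^ 2)) (hn : ¬IsSquare (C ^ 2 - d * D ^ 2)) :
    IsSquare ((A ^ 2 - d * B ^ 2) * (C ^ 2 - d * D ^ 2)) := by
  have ne0 : ∀ x : K, ¬IsSquare x → x ≠ 0 := by rintro x hx rfl; exact hx IsSquare.zero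
  by_cases hde : Even (ν d)
  · exact h.isSquare_mul_of_even h2 (ne0 _ hm) (ne0 _ hn)
      (h.even_map_sq_sub h2 hd hde (ne0 _ hm)) (h.even_map_sq_sub h2 hd hde (ne0 _ hn)) hm hn
  · have hmo := mt (h.isSquare_sq_sub h2 (ne0 d hd) hde) hm
    have hno := mt (h.isSquare_sq_sub h2 (ne0 d hd) hde) hn
    have key : (A ^ 2 - d * B ^ 2) * (C ^ 2 - d * D ^ 2) =
        (A * C + d * B * D) ^ 2 - d * (A * D + B * C) ^ 2 := by ring
    have hev : Even (ν ((A ^ 2 - d * B ^ 2) * (C ^ 2 - d * D ^ 2))) := by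
      rw [h.map_mul _ _ (ne0 _ hm) (ne0 _ hn)]
      exact Int.even_add.2 (by simp [hmo, hno])
    rw [key] at hev ⊢
    exact h.isSquare_sq_sub h2 (ne0 d hd) hde hev

/-- For `d` a nonsquare, `-d` is a square exactly when `d` has even valuation and `-1` is not a
square. -/
theorem isSquare_neg_iff (h : IsNALocalField ν) (h2 : OddResidualChar ν) {d : K}
    (hd : ¬IsSquare d) : IsSquare (-d) ↔ Even (ν d) ∧ ¬IsSquare (-1 : K) := by
  have hd0 : d ≠ 0 := by rintro rfl; exact hd IsSquare.zero
  constructor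
  · intro hs
    refine ⟨?_, fun h1 => hd (by simpa using h1.mul hs)⟩
    obtain ⟨r, hr⟩ := hs
    have hr0 : r ≠ 0 := by rintro rfl; simp [hd0] at hr
    rw [← h.map_neg, hr, ← pow_two, h.map_sq hr0]
    exact even_two_mul _
  · rintro ⟨hde, h1⟩
    have := h.isSquare_mul_of_even h2 (neg_ne_zero.2 one_ne_zero) hd0
      (by simp [h.map_neg, h.map_one]) hde h1 hd
    simpa using this

end IsNALocalField

section Biquadratic

variable {F E : Type*} [Field F] [Field E] [Algebra F E]

/-- An automorphism `τ` completing the nontrivial automorphism `σ` to a pair of generators of the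
Galois group of a biquadratic extension. -/
theorem IsBiquadratic.exists_generator [FiniteDimensional F E] (h : IsBiquadratic F E)
    {σ : E ≃ₐ[F] E} (hσ : σ ≠ AlgEquiv.refl) :
    ∃ τ : E ≃ₐ[F] E, τ ≠ AlgEquiv.refl ∧ τ ≠ σ ∧ (∀ x, τ (τ x) = x) ∧
      (∀ x, τ (σ x) = σ (τ x)) ∧
      (∀ x, σ x = x → τ x = x → ∃ t, algebraMap F E t = x) ∧
      ∀ x, algebraMap F E (Algebra.trace F E x) = x + σ x + τ x + σ (τ x) := by
  classical
  obtain ⟨_, ⟨e⟩⟩ := h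
  have hcard : Fintype.card (E ≃ₐ[F] E) = 4 := by
    rw [← Nat.card_eq_fintype_card, Nat.card_congr e.toEquiv,
      Nat.card_congr Multiplicative.toAdd, Nat.card_prod, Nat.card_zmod]
  have hsq : ∀ g : E ≃ₐ[F] E, g * g = 1 := by
    intro g
    apply e.injective
    rw [map_mul, map_one]
    generalize e g = x
    revert x
    decide
  have hcomm : ∀ g g' : E ≃ₐ[F] E, g * g' = g' * g := by
    intro g g'
    apply e.injective
    rw [map_mul, map_mul, mul_comm]
  have hσ1 : σ ≠ 1 := hσ
  obtain ⟨τ, hτ⟩ : ∃ τ, τ ∉ ({1, σ} : Finset (E ≃ₐ[F] E)) := by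
    by_contra! hall
    have h1 : Finset.univ ⊆ ({1, σ} : Finset (E ≃ₐ[F] E)) := fun τ _ => hall τ
    have h2 := (Finset.card_le_card h1).trans Finset.card_le_two
    rw [Finset.card_univ, hcard] at h2
    omega
  obtain ⟨hτ1, hτσ⟩ : τ ≠ 1 ∧ τ ≠ σ := by simpa using hτ
  have hστ1 : σ * τ ≠ 1 := fun h1 => hτσ (mul_left_cancel (h1.trans (hsq σ).symm))
  have hστσ : σ * τ ≠ σ := fun h1 => hτ1 (mul_left_cancel (h1.trans (mul_one σ).symm))
  have hσττ : σ * τ ≠ τ := fun h1 => hσ1 (mul_right_cancel (h1.trans (one_mul τ).symm))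
  have huniv : ({1, σ, τ, σ * τ} : Finset (E ≃ₐ[F] E)) = Finset.univ := by
    apply Finset.eq_univ_of_card
    rw [hcard]
    rw [Finset.card_insert_of_notMem, Finset.card_insert_of_notMem, Finset.card_pair hσττ.symm]
    · simp [hτσ.symm, hστσ.symm]
    · simp [hσ1.symm, hτ1.symm, hστ1.symm]
  refine ⟨τ, hτ1, hτσ, fun x => DFunLike.congr_fun (hsq τ) x,
    fun x => DFunLike.congr_fun (hcomm τ σ) x, fun x hσx hτx => ?_, fun x => ?_⟩
  · rw [← Set.mem_range, ← IntermediateField.mem_bot, IsGalois.mem_bot_iff_fixed]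
    intro g
    have hg := Finset.mem_univ g
    rw [← huniv] at hg
    simp only [Finset.mem_insert, Finset.mem_singleton] at hg
    rcases hg with rfl | rfl | rfl | rfl
    · rfl
    · exact hσx
    · exact hτx
    · rw [AlgEquiv.mul_apply, hτx, hσx]
  · rw [trace_eq_sum_automorphisms, ← huniv, Finset.sum_insert, Finset.sum_insert,
      Finset.sum_pair hσττ.symm]
    · simp only [AlgEquiv.one_apply, AlgEquiv.mul_apply]
      ring
    · simp [hτσ.symm, hστσ.symm]
    · simp [hσ1.symm, hτ1.symm, hστ1.symm]

/-- Coordinates on the fixed field of `h`, generated over `F` by the square root `p`. -/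
theorem exists_coordinates {g h : E ≃ₐ[F] E} (hg : ∀ x, g (g x) = x)
    (hgh : ∀ x, h (g x) = g (h x))
    (hfix : ∀ x, h x = x → g x = x → ∃ t, algebraMap F E t = x) (h2 : (2 : E) ≠ 0)
    {p : E} (hp0 : p ≠ 0) (hp : h p = p) (hgp : g p = -p) {X : E} (hX : h X = X) :
    ∃ A B : F, X = algebraMap F E A + algebraMap F E B * p := by
  obtain ⟨A, hA⟩ := hfix ((X + g X) / 2) (by simp [hX, hgh, map_ofNat h 2])
    (by simp [hg, add_comm, map_ofNat g 2])
  obtain ⟨B, hB⟩ := hfix ((X - g X) / (2 * p)) (by simp [hX, hgh, hp, map_ofNat h 2]) (by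
    simp only [map_div₀, map_sub, map_mul, map_ofNat, hg, hgp]
    field_simp
    ring)
  refine ⟨A, B, ?_⟩
  rw [hA, hB]
  field_simp
  ring

theorem exists_norm_form {g h : E ≃ₐ[F] E} (hg : ∀ x, g (g x) = x)
    (hgh : ∀ x, h (g x) = g (h x))
    (hfix : ∀ x, h x = x → g x = x → ∃ t, algebraMap F E t = x) (h2 : (2 : E) ≠ 0)
    {p : E} (hp0 : p ≠ 0) (hp : h p = p) (hgp : g p = -p) {d : F}
    (hd : algebraMap F E d = p ^ 2) {X : E} (hX : h X = X) {n : F}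
    (hn : algebraMap F E n = X * g X) : ∃ A B : F, n = A ^ 2 - d * B ^ 2 := by
  obtain ⟨A, B, rfl⟩ := exists_coordinates hg hgh hfix h2 hp0 hp hgp hX
  refine ⟨A, B, (algebraMap F E).injective ?_⟩
  simp only [hn, map_add, map_sub, map_mul, map_pow, AlgEquiv.commutes, hgp, hd]
  ring

theorem not_isSquare_of_map_eq_neg (h2 : (2 : E) ≠ 0) {g : E ≃ₐ[F] E} {p : E} (hp0 : p ≠ 0)
    (hgp : g p = -p) {b : F} (hb : algebraMap F E b = p ^ 2) : ¬IsSquare b := by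
  rintro ⟨s, rfl⟩
  rw [map_mul, ← pow_two, sq_eq_sq_iff_eq_or_eq_neg] at hb
  have hp : g p = p := by
    rcases hb with hb | hb
    · rw [← hb, AlgEquiv.commutes]
    · rw [← neg_eq_iff_eq_neg.2 hb, map_neg, AlgEquiv.commutes]
  rw [hgp, neg_eq_iff_add_eq_zero, ← two_mul] at hp
  exact mul_ne_zero h2 hp0 hp

/-- Membership in the group `F^× · (E₀^×)²`, where `E₀` is the fixed field of `σ`. -/
def IsScaledSquare (σ : E ≃ₐ[F] E) (z : E) : Prop :=
  ∃ t : F, ∃ y : E, t ≠ 0 ∧ y ≠ 0 ∧ σ y = y ∧ z = algebraMap F E t * y ^ 2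

/-- By Hilbert 90, `F^× · (E₀^×)²` consists of the elements whose norm to `F` is a square. -/
theorem isScaledSquare_iff {σ τ : E ≃ₐ[F] E} (hτ : ∀ x, τ (τ x) = x)
    (hστ : ∀ x, τ (σ x) = σ (τ x))
    (hfix : ∀ x, σ x = x → τ x = x → ∃ t, algebraMap F E t = x)
    {w : E} (hw0 : w ≠ 0) (hσw : σ w = w) {d : F} (hd : algebraMap F E d = w ^ 2)
    {z : E} (hz0 : z ≠ 0) (hσz : σ z = z) {n : F} (hn : algebraMap F E n = z * τ z) :
    IsScaledSquare σ z ↔ IsSquare n := by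
  have hnorm : ∀ y, σ y = y → ∃ m, algebraMap F E m = y * τ y := fun y hy =>
    hfix _ (by rw [map_mul, ← hστ, hy]) (by rw [map_mul, hτ, mul_comm])
  constructor
  · rintro ⟨t, y, -, -, hσy, rfl⟩
    obtain ⟨m, hm⟩ := hnorm y hσy
    refine ⟨t * m, (algebraMap F E).injective ?_⟩
    simp only [hn, map_mul, map_pow, AlgEquiv.commutes, hm]
    ring
  · rintro ⟨s, rfl⟩
    have hτz0 : τ z ≠ 0 := by simpa using hz0
    have hs0 : s ≠ 0 := by
      rintro rfl
      simp [hz0] at hn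
    have hd0 : d ≠ 0 := by
      rintro rfl
      rw [map_zero] at hd
      exact pow_ne_zero 2 hw0 hd.symm
    rcases eq_or_ne (algebraMap F E s + z) 0 with h0 | h0
    · refine ⟨-s / d, w, div_ne_zero (neg_ne_zero.2 hs0) hd0, hw0, hσw, ?_⟩
      rw [← hd, ← map_mul, div_mul_cancel₀ _ hd0, map_neg]
      exact eq_neg_of_add_eq_zero_right h0
    · have hσy : σ (algebraMap F E s + z) = algebraMap F E s + z := by
        rw [map_add, AlgEquiv.commutes, hσz]
      obtain ⟨m, hm⟩ := hnorm _ hσy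
      have hm0 : m ≠ 0 := by
        rintro rfl
        have : τ (algebraMap F E s + z) ≠ 0 := (map_ne_zero τ).2 h0
        rw [map_zero] at hm
        exact mul_ne_zero h0 this hm.symm
      refine ⟨s / m, _, div_ne_zero hs0 hm0, h0, hσy, ?_⟩
      have hm0' : algebraMap F E m ≠ 0 := by simpa using hm0
      rw [map_div₀, div_mul_eq_mul_div, eq_div_iff hm0', hm, map_add, AlgEquiv.commutes]
      rw [map_mul] at hn
      linear_combination (-(algebraMap F E s + z)) * hn

/-- The extension `E₀ = F(√d)` is unramified exactly when `d` has even valuation. -/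
theorem dvd_valuation_iff {νF : F → ℤ} {νE : E → ℤ} (hF : IsNALocalField νF)
    (hE : IsNALocalField νE) (hodd : OddResidualChar νF) {e : ℤ} (he : 0 < e)
    (hcompat : ∀ t : F, t ≠ 0 → νE (algebraMap F E t) = e * νF t)
    {σ τ : E ≃ₐ[F] E} (hτ : ∀ x, τ (τ x) = x) (hστ : ∀ x, σ (τ x) = τ (σ x))
    (hfix : ∀ x, σ x = x → τ x = x → ∃ t, algebraMap F E t = x) (h2 : (2 : E) ≠ 0)
    {w : E} (hw0 : w ≠ 0) (hσw : σ w = w) (hτw : τ w = -w) {d : F}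
    (hd : algebraMap F E d = w ^ 2) (hds : ¬IsSquare d) :
    (∀ x : E, x ≠ 0 → σ x = x → e ∣ νE x) ↔ Even (νF d) := by
  have hd0 : d ≠ 0 := by rintro rfl; exact hds IsSquare.zero
  have hνw : 2 * νE w = e * νF d := by rw [← hcompat d hd0, hd, hE.map_sq hw0]
  constructor
  · intro hdvd
    obtain ⟨m, hm⟩ := hdvd w hw0 hσw
    have h3 : e * νF d = e * (2 * m) := by rw [← hνw, hm]; ring
    exact ⟨m, by rw [mul_left_cancel₀ he.ne' h3, two_mul]⟩
  · rintro ⟨k, hk⟩ x hx0 hσx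
    have hwk : νE w = e * k := by
      have : 2 * νE w = 2 * (e * k) := by rw [hνw, hk]; ring
      omega
    obtain ⟨A, B, rfl⟩ := exists_coordinates hτ hστ hfix h2 hw0 hσw hτw hσx
    have hνB : B ≠ 0 → νE (algebraMap F E B * w) = e * (νF B + k) := fun hB => by
      rw [hE.map_mul _ _ (by simpa using hB) hw0, hcompat B hB, hwk]
      ring
    rcases eq_or_ne B 0 with rfl | hB
    · have hA : A ≠ 0 := by rintro rfl; simp at hx0
      simp [hcompat A hA]
    have hB0 : algebraMap F E B * w ≠ 0 := mul_ne_zero (by simpa using hB) hw0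
    rcases eq_or_ne A 0 with rfl | hA
    · simp [hνB hB]
    have hA0 : algebraMap F E A ≠ 0 := by simpa using hA
    have hνA := hcompat A hA
    have hνB := hνB hB
    rcases lt_trichotomy (νE (algebraMap F E A)) (νE (algebraMap F E B * w)) with hlt | heq | hlt
    · rw [hE.map_add_of_lt hA0 hB0 hlt, hνA]
      exact dvd_mul_right _ _
    · have hAB : νF A = νF B + k := mul_left_cancel₀ he.ne' (by rw [← hνA, heq, hνB])
      have hn := hF.map_sq_sub_of_even hodd hds hA hB (by omega)
      have hn0 : A ^ 2 - d * B ^ 2 ≠ 0 := by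
        intro h0
        refine hds ⟨A / B, ?_⟩
        field_simp
        linear_combination -h0
      have hprod : algebraMap F E (A ^ 2 - d * B ^ 2) =
          (algebraMap F E A + algebraMap F E B * w) *
            (algebraMap F E A + -(algebraMap F E B * w)) := by
        rw [map_sub, map_mul, map_pow, map_pow, hd]
        ring
      have hx'0 : algebraMap F E A + -(algebraMap F E B * w) ≠ 0 := by
        intro h0
        rw [h0, mul_zero] at hprod
        exact hn0 ((map_eq_zero _).1 hprod)
      have h3 := hE.ultrametric _ _ hA0 hB0 hx0
      have h4 := hE.ultrametric _ _ hA0 (neg_ne_zero.2 hB0) hx'0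
      have h5 := hcompat _ hn0
      rw [hprod, hE.map_mul _ _ hx0 hx'0, hn] at h5
      rw [hE.map_neg] at h4
      have h6 : e * (2 * νF A) = 2 * (e * νF A) := by ring
      refine ⟨νF A, ?_⟩
      omega
    · rw [add_comm, hE.map_add_of_lt hB0 hA0 hlt, hνB]
      exact dvd_mul_right _ _

/-- The norm to `F` of an element of a biquadratic extension `F(√d, √a)` is a square. -/
theorem isSquare_norm {νF : F → ℤ} (hF : IsNALocalField νF) (hodd : OddResidualChar νF)
    {σ τ : E ≃ₐ[F] E} (hσ : ∀ x, σ (σ x) = x) (hτ : ∀ x, τ (τ x) = x)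
    (hτσ : ∀ x, τ (σ x) = σ (τ x))
    (hfix : ∀ x, σ x = x → τ x = x → ∃ t, algebraMap F E t = x) (h2 : (2 : E) ≠ 0)
    {w u : E} (hw0 : w ≠ 0) (hσw : σ w = w) (hτw : τ w = -w)
    (hu0 : u ≠ 0) (hσu : σ u = -u) (hτu : τ u = u) {d a : F}
    (hd : algebraMap F E d = w ^ 2) (ha : algebraMap F E a = u ^ 2)
    {x : E} (hx0 : x ≠ 0) {n : F}
    (hn : algebraMap F E n = x * σ x * τ (x * σ x)) : IsSquare n := by
  have hda : algebraMap F E (d * a) = (w * u) ^ 2 := by rw [map_mul, hd, ha, mul_pow]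
  refine hF.isSquare_of_forall_norm hodd (not_isSquare_of_map_eq_neg h2 hw0 hτw hd)
    (not_isSquare_of_map_eq_neg h2 hu0 hσu ha)
    (not_isSquare_of_map_eq_neg (g := σ) h2 (mul_ne_zero hw0 hu0) (by simp [hσw, hσu]) hda) ?_ ?_ ?_ ?_
  · rintro rfl
    simp [hx0] at hn
  · exact exists_norm_form hτ (fun y => (hτσ y).symm) hfix h2 hw0 hσw hτw hd
      (X := x * σ x) (by rw [map_mul, hσ, mul_comm]) hn
  · refine exists_norm_form hσ hτσ (fun y h3 h4 => hfix y h4 h3) h2 hu0 hτu hσu ha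
      (X := x * τ x) (by rw [map_mul, hτ, mul_comm]) ?_
    rw [hn, map_mul, map_mul, hτσ]
    ring
  · refine exists_norm_form (h := τ.trans σ) hσ (fun y => ?_) (fun y h3 h4 => ?_) h2
      (mul_ne_zero hw0 hu0) ?_ ?_ hda (X := x * σ (τ x)) ?_ ?_
    · simp [hτσ]
    · refine hfix y h4 ?_
      rwa [AlgEquiv.trans_apply, ← hτσ, h4] at h3
    · simp [hσw, hτw, hτu, hσu]
    · simp [hσw, hσu]
    · simp [hτσ, hσ, hτ, mul_comm]
    · rw [hn, map_mul, map_mul, hτσ, hσ]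
      ring

end Biquadratic

theorem isSquare_mul_iff_of_isSquare {K : Type*} [Field K] {m k : K} (hk0 : k ≠ 0)
    (hk : IsSquare k) : IsSquare (m * k) ↔ IsSquare m := by
  refine ⟨fun h => ?_, fun h => h.mul hk⟩
  simpa [hk0] using h.div hk

/-- Remark at the end of §3.2.
Assume `E/F` biquadratic (setup as in Statement 4).  Encodings: `E₀` is the
fixed field of `σ`; "`E₀/F` unramified" is `ν_E(E₀^×) ⊆ e(E/F)·ℤ`;
"`|k_F| ≡ 3 (mod 4)`" is "`−1` is not a square in `F`" (equivalent, by
Hensel's lemma, for a local field of odd residual characteristic).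
If `E₀/F` is unramified and `|k_F| ≡ 3 (mod 4)`, then `q(x) = h(x, βx)` is
anisotropic iff `β δ₀ ∉ F^×·(E₀^×)²`; in all other cases `q` is anisotropic
iff `β δ₀ ∈ F^×·(E₀^×)²`. -/
theorem anisotropy_criterion_biquadratic_refined
    {F E : Type*} [Field F] [Field E] [Algebra F E] [FiniteDimensional F E]
    (νF : F → ℤ) (νE : E → ℤ)
    (hF : IsNALocalField νF) (hE : IsNALocalField νE)
    (hodd : OddResidualChar νF)
    (hdim : Module.finrank F E = 4)
    (eEF : ℤ) (heEF : 0 < eEF)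
    (hcompat : ∀ t : F, t ≠ 0 → νE (algebraMap F E t) = eEF * νF t)
    (σ : E ≃ₐ[F] E) (hσ2 : ∀ x : E, σ (σ x) = x)
    (hσne : σ ≠ (AlgEquiv.refl : E ≃ₐ[F] E))
    (β : E) (hβskew : σ β = -β) (hβgen : Algebra.adjoin F {β} = ⊤)
    (δ₀ : E) (hδ₀ : δ₀ ≠ 0) (hδ₀skew : σ δ₀ = -δ₀)
    (hbiq : IsBiquadratic F E) :
    (((∀ x : E, x ≠ 0 → σ x = x → eEF ∣ νE x) ∧ ¬∃ i : F, i ^ 2 = -1) →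
      ((∀ x : E, Algebra.trace F E (δ₀ * x * σ (β * x)) = 0 → x = 0) ↔
        ¬∃ t : F, ∃ y : E, t ≠ 0 ∧ y ≠ 0 ∧ σ y = y ∧
          β * δ₀ = algebraMap F E t * y ^ 2)) ∧
    ((¬((∀ x : E, x ≠ 0 → σ x = x → eEF ∣ νE x) ∧ ¬∃ i : F, i ^ 2 = -1)) →
      ((∀ x : E, Algebra.trace F E (δ₀ * x * σ (β * x)) = 0 → x = 0) ↔
        ∃ t : F, ∃ y : E, t ≠ 0 ∧ y ≠ 0 ∧ σ y = y ∧
          β * δ₀ = algebraMap F E t * y ^ 2)) := by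
  have hFE : Function.Injective (algebraMap F E) := (algebraMap F E).injective
  have h2 : (2 : E) ≠ 0 := by
    have := (map_ne_zero (algebraMap F E)).2 hodd.1
    rwa [map_ofNat] at this
  obtain ⟨τ, hτ1, hτσ, hτ2, hcomm, hfix, htrace⟩ := hbiq.exists_generator hσne
  have ext_beta : ∀ g g' : E ≃ₐ[F] E, g β = g' β → g = g' := by
    intro g g' hgg
    have h3 : (g : E →ₐ[F] E) = g' :=
      AlgHom.ext_of_adjoin_eq_top hβgen (by rintro _ rfl; exact hgg)
    exact AlgEquiv.ext fun x => DFunLike.congr_fun h3 x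
  have hβ0 : β ≠ 0 := by
    rintro rfl
    exact hσne (ext_beta _ _ (by simp))
  -- square roots generating the quadratic subextensions
  obtain ⟨w, hw0, hσw, hτw⟩ : ∃ w : E, w ≠ 0 ∧ σ w = w ∧ τ w = -w := by
    refine ⟨β ^ 2 - τ (β ^ 2), fun h0 => ?_, ?_, ?_⟩
    · rw [sub_eq_zero, map_pow, sq_eq_sq_iff_eq_or_eq_neg] at h0
      rcases h0 with h0 | h0
      · exact hτ1 (ext_beta _ _ h0.symm)
      · exact hτσ (ext_beta _ _ (by rw [hβskew, neg_eq_iff_eq_neg.2 h0]))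
    · rw [map_sub, ← hcomm, map_pow, hβskew, neg_sq]
    · rw [map_sub, hτ2, neg_sub]
  obtain ⟨u, hu0, hσu, hτu⟩ : ∃ u : E, u ≠ 0 ∧ σ u = -u ∧ τ u = u := by
    refine ⟨β + τ β, fun h0 => ?_, ?_, ?_⟩
    · exact hτσ (ext_beta _ _ (by rw [hβskew, eq_neg_of_add_eq_zero_right h0]))
    · rw [map_add, ← hcomm, hβskew, map_neg]
      ring
    · rw [map_add, hτ2, add_comm]
  obtain ⟨d, hd⟩ := hfix (w ^ 2) (by rw [map_pow, hσw]) (by rw [map_pow, hτw, neg_sq])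
  obtain ⟨a, ha⟩ := hfix (u ^ 2) (by rw [map_pow, hσu, neg_sq]) (by rw [map_pow, hτu])
  have hds : ¬IsSquare d := not_isSquare_of_map_eq_neg h2 hw0 hτw hd
  -- the form `q` is a scaled trace of the norm form with coefficient `c`
  obtain ⟨c, hc⟩ : ∃ c, c = β * δ₀ := ⟨_, rfl⟩
  rw [← hc]
  have hc0 : c ≠ 0 := hc ▸ mul_ne_zero hβ0 hδ₀
  have hσc : σ c = c := by rw [hc, map_mul, hβskew, hδ₀skew, neg_mul_neg]
  have hform : ∀ x : E, Algebra.trace F E (δ₀ * x * σ (β * x)) = 0 ↔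
      τ (c * (x * σ x)) = -(c * (x * σ x)) := by
    intro x
    have hz : δ₀ * x * σ (β * x) = -(c * (x * σ x)) := by
      rw [map_mul, hβskew, hc]
      ring
    have hσz : σ (c * (x * σ x)) = c * (x * σ x) := by
      rw [map_mul, map_mul, hσ2, hσc, mul_comm x]
    rw [hz, map_neg, neg_eq_zero, ← map_eq_zero (algebraMap F E), htrace, ← hcomm, hσz,
      eq_neg_iff_add_eq_zero]
    constructor
    · intro h0
      refine (mul_eq_zero.1 (?_ : (2 : E) * _ = 0)).resolve_left h2
      linear_combination h0
    · intro h0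
      linear_combination 2 * h0
  have hnorm : ∀ y, σ y = y → ∃ m, algebraMap F E m = y * τ y := fun y hy =>
    hfix _ (by rw [map_mul, ← hcomm, hy]) (by rw [map_mul, hτ2, mul_comm])
  obtain ⟨m, hm⟩ := hnorm c hσc
  have hcw0 : c * w ≠ 0 := mul_ne_zero hc0 hw0
  have hσcw : σ (c * w) = c * w := by rw [map_mul, hσc, hσw]
  have hmw : algebraMap F E (m * -d) = c * w * τ (c * w) := by
    rw [map_mul, map_neg, hm, hd, map_mul, hτw]
    ring
  have hcSquare : IsScaledSquare σ c ↔ IsSquare m :=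
    isScaledSquare_iff hτ2 hcomm hfix hw0 hσw hd hc0 hσc hm
  have hcwSquare : IsScaledSquare σ (c * w) ↔ IsSquare (m * -d) :=
    isScaledSquare_iff hτ2 hcomm hfix hw0 hσw hd hcw0 hσcw hmw
  have haniso : (∀ x : E, Algebra.trace F E (δ₀ * x * σ (β * x)) = 0 → x = 0) ↔
      ¬IsScaledSquare σ (c * w) := by
    constructor
    · rintro hx ⟨t, y, ht, hy0, hσy, hy⟩
      refine inv_ne_zero hy0 (hx y⁻¹ ((hform _).2 ?_))
      have hz : c * (y⁻¹ * σ y⁻¹) = algebraMap F E t / w := by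
        rw [map_inv₀, hσy, eq_div_iff hw0]
        field_simp
        rw [hy, mul_comm]
      rw [hz, map_div₀, AlgEquiv.commutes, hτw, div_neg]
    · intro hn x hx
      rw [hform] at hx
      by_contra hx0
      have hN0 : x * σ x ≠ 0 := mul_ne_zero hx0 ((map_ne_zero σ).2 hx0)
      have hσN : σ (x * σ x) = x * σ x := by rw [map_mul, hσ2, mul_comm]
      obtain ⟨n, hnN⟩ := hnorm _ hσN
      have hnsq : IsSquare n :=
        isSquare_norm hF hodd hσ2 hτ2 hcomm hfix h2 hw0 hσw hτw hu0 hσu hτu hd ha hx0 hnN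
      obtain ⟨f, hf⟩ := hfix (c * (x * σ x) * w) (by rw [map_mul, map_mul, hσN, hσc, hσw])
        (by rw [map_mul, hx, hτw, neg_mul_neg])
      have hn0 : n ≠ 0 := by
        rintro rfl
        rw [map_zero] at hnN
        exact mul_ne_zero hN0 ((map_ne_zero τ).2 hN0) hnN.symm
      refine hn (hcwSquare.2 ((isSquare_mul_iff_of_isSquare hn0 hnsq).1 ⟨f, hFE ?_⟩))
      have hτf : τ (c * (x * σ x) * w) = algebraMap F E f := by rw [← hf, AlgEquiv.commutes]
      rw [map_mul, hmw, hnN, map_mul (algebraMap F E)]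
      nth_rewrite 1 [hf]
      rw [← hτf]
      simp only [map_mul]
      ring
  have hcase : ((∀ x : E, x ≠ 0 → σ x = x → eEF ∣ νE x) ∧ ¬∃ i : F, i ^ 2 = -1) ↔
      IsSquare (-d) := by
    rw [hF.isSquare_neg_iff hodd hds, dvd_valuation_iff hF hE hodd heEF hcompat hτ2
      (fun x => (hcomm x).symm) hfix h2 hw0 hσw hτw hd hds, isSquare_iff_exists_sq]
    simp only [eq_comm]
  have hd0 : -d ≠ 0 := by
    rw [neg_ne_zero]
    rintro rfl
    exact hds IsSquare.zero
  rw [haniso, hcwSquare, hcase]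
  change (_ → (_ ↔ ¬IsScaledSquare σ c)) ∧ (_ → (_ ↔ IsScaledSquare σ c))
  rw [hcSquare]
  constructor
  · intro hsq
    rw [isSquare_mul_iff_of_isSquare hd0 hsq]
  · intro hsq
    constructor
    · intro h3
      by_contra h4
      obtain ⟨A, B, rfl⟩ := exists_norm_form hτ2 (fun x => (hcomm x).symm) hfix h2 hw0 hσw hτw hd
        hσc hm
      have h5 : -d = 0 ^ 2 - d * 1 ^ 2 := by ring
      rw [h5] at hsq h3
      exact h3 (hF.isSquare_mul_of_norm hodd hds h4 hsq)
    · intro h3 h4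
      rw [mul_comm] at h4
      have hm0 : m ≠ 0 := by
        rintro rfl
        rw [map_zero] at hm
        exact mul_ne_zero hc0 ((map_ne_zero τ).2 hc0) hm.symm
      exact hsq ((isSquare_mul_iff_of_isSquare hm0 h3).1 h4)
end

section
/- The quadratic form q(v) = h(v, βv) on V is anisotropic (i.e. q(v) = 0 implies v = 0) if and only if β₁ β₂⁻¹ ∉ u₁u₂ · N_{E/F}(E^×); here β₁β₂⁻¹ and u₁u₂ both lie in F^×. (Case (iii) of Proposition 4.2, combined with Proposition 4.1, in the case E₁ ≅ E₂; u₁u₂ represents the determinant of the skew-hermitian form δ.) -/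
section SkewElements

variable {F E : Type*} [Field F] [Field E] [Algebra F E]

/-- A nonzero element `u` negated by an automorphism of a quadratic extension spans it together
with `1`. -/
theorem exists_eq_add_mul_of_map_eq_neg (h2 : (2 : F) ≠ 0)
    (hdim : Module.finrank F E = 2) (σ : E ≃ₐ[F] E) {u : E} (hu : u ≠ 0) (hus : σ u = -u)
    (x : E) : ∃ a b : F, x = algebraMap F E a + algebraMap F E b * u := by
  have h2E : (2 : E) ≠ 0 := by
    simpa only [map_ofNat] using (map_ne_zero (algebraMap F E)).2 h2
  have : FiniteDimensional F E := Module.finite_of_finrank_eq_succ hdim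
  have hli : LinearIndependent F ![(1 : E), u] := by
    rw [LinearIndependent.pair_iff]
    intro s t hst
    have hσ := congrArg σ hst
    simp only [Algebra.smul_def, map_add, map_mul, AlgEquiv.commutes, map_zero, hus,
      mul_one] at hst hσ
    have hs : (2 : E) * algebraMap F E s = 0 := by linear_combination hst + hσ
    have hs0 : algebraMap F E s = 0 := (mul_eq_zero.1 hs).resolve_left h2E
    have ht0 : algebraMap F E t = 0 := by
      rw [hs0, zero_add] at hst
      exact (mul_eq_zero.1 hst).resolve_right hu
    simpa using And.intro hs0 ht0
  have hspan := hli.span_eq_top_of_card_eq_finrank' (by simp [hdim])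
  have hx : x ∈ Submodule.span F (Set.range ![(1 : E), u]) := hspan ▸ Submodule.mem_top
  rw [Matrix.range_cons, Matrix.range_cons, Matrix.range_empty, Set.union_empty,
    Set.singleton_union, Submodule.mem_span_pair] at hx
  obtain ⟨a, b, rfl⟩ := hx
  exact ⟨a, b, by simp [Algebra.smul_def]⟩

theorem apply_apply_of_map_eq_neg (h2 : (2 : F) ≠ 0)
    (hdim : Module.finrank F E = 2) (σ : E ≃ₐ[F] E) {u : E} (hu : u ≠ 0) (hus : σ u = -u)
    (x : E) : σ (σ x) = x := by
  obtain ⟨a, b, rfl⟩ := exists_eq_add_mul_of_map_eq_neg h2 hdim σ hu hus x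
  simp [hus]

theorem exists_algebraMap_eq_of_map_eq_self (h2 : (2 : F) ≠ 0)
    (hdim : Module.finrank F E = 2) (σ : E ≃ₐ[F] E) {u : E} (hu : u ≠ 0) (hus : σ u = -u)
    {x : E} (hx : σ x = x) : ∃ t : F, algebraMap F E t = x := by
  obtain ⟨a, b, rfl⟩ := exists_eq_add_mul_of_map_eq_neg h2 hdim σ hu hus x
  have h2E : (2 : E) ≠ 0 := by
    simpa only [map_ofNat] using (map_ne_zero (algebraMap F E)).2 h2
  simp only [map_add, map_mul, AlgEquiv.commutes, hus] at hx
  have hb : (2 : E) * (algebraMap F E b * u) = 0 := by linear_combination -hx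
  exact ⟨a, by simp [(mul_eq_zero.1 hb).resolve_left h2E]⟩

theorem trace_eq_zero_iff_of_map_eq_self (h2 : (2 : F) ≠ 0)
    (hdim : Module.finrank F E = 2) (σ : E ≃ₐ[F] E) {u : E} (hu : u ≠ 0) (hus : σ u = -u)
    {x : E} (hx : σ x = x) : Algebra.trace F E x = 0 ↔ x = 0 := by
  obtain ⟨t, rfl⟩ := exists_algebraMap_eq_of_map_eq_self h2 hdim σ hu hus hx
  simp [Algebra.trace_algebraMap, hdim, h2]

end SkewElements


/-- case (iii) of Proposition 4.2 with Proposition 4.1, in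
the case `E₁ ≅ E₂ = E`.
With `V = E ⊕ E`, `h((x₁,x₂),(y₁,y₂)) = tr_{E/F}(u₁x₁σ(y₁)) + tr_{E/F}(u₂x₂σ(y₂))`
and `β(x₁,x₂) = (β₁x₁, β₂x₂)` for skew `β₁, β₂, u₁, u₂ ∈ E^×`, the quadratic
form `q(v) = h(v, βv)` is anisotropic iff
`β₁β₂⁻¹ ∉ u₁u₂·N_{E/F}(E^×)`; moreover `β₁β₂⁻¹` and `u₁u₂` lie in `F^×`. -/
theorem anisotropic_iff_ratio_not_in_norms
    {F E : Type*} [Field F] [Field E] [Algebra F E] [FiniteDimensional F E]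
    (ν : F → ℤ) (hF : IsNALocalField ν) (hodd : OddResidualChar ν)
    (hdim : Module.finrank F E = 2)
    (σ : E ≃ₐ[F] E) (hσne : σ ≠ (AlgEquiv.refl : E ≃ₐ[F] E))
    (β₁ β₂ u₁ u₂ : E)
    (hβ₁ : β₁ ≠ 0) (hβ₂ : β₂ ≠ 0) (hu₁ : u₁ ≠ 0) (hu₂ : u₂ ≠ 0)
    (hβ₁s : σ β₁ = -β₁) (hβ₂s : σ β₂ = -β₂)
    (hu₁s : σ u₁ = -u₁) (hu₂s : σ u₂ = -u₂) :
    (∃ t : F, algebraMap F E t = β₁ * β₂⁻¹) ∧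
    (∃ t : F, algebraMap F E t = u₁ * u₂) ∧
    ((∀ v : E × E,
        Algebra.trace F E (u₁ * v.1 * σ (β₁ * v.1)) +
            Algebra.trace F E (u₂ * v.2 * σ (β₂ * v.2)) = 0 → v = 0) ↔
      ¬∃ w : E, w ≠ 0 ∧ β₁ * β₂⁻¹ = u₁ * u₂ * (w * σ w)) := by
  have h2 := hodd.1
  refine ⟨exists_algebraMap_eq_of_map_eq_self h2 hdim σ hu₁ hu₁s (by simp [hβ₁s, hβ₂s, inv_neg]),
    exists_algebraMap_eq_of_map_eq_self h2 hdim σ hu₁ hu₁s (by simp [hu₁s, hu₂s]), ?_⟩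
  have hσσ := apply_apply_of_map_eq_neg h2 hdim σ hu₁ hu₁s
  have hq : ∀ v : E × E,
      Algebra.trace F E (u₁ * v.1 * σ (β₁ * v.1)) +
        Algebra.trace F E (u₂ * v.2 * σ (β₂ * v.2)) = 0 ↔
      u₁ * β₁ * (v.1 * σ v.1) + u₂ * β₂ * (v.2 * σ v.2) = 0 := by
    intro v
    rw [← map_add, trace_eq_zero_iff_of_map_eq_self h2 hdim σ hu₁ hu₁s, ← neg_eq_zero]
    · simp only [map_mul, hβ₁s, hβ₂s]
      ring_nf
    · simp only [map_add, map_mul, map_neg, hσσ, hβ₁s, hβ₂s, hu₁s, hu₂s]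
      ring
  simp only [hq]
  constructor
  · rintro h ⟨w, -, hw⟩
    have hβ : β₁ = u₁ * u₂ * (w * σ w) * β₂ := by rw [← hw]; field_simp
    have := h (1, u₁ * w) (by simp only [map_mul, map_one, hu₁s]; rw [hβ]; ring)
    simp at this
  · intro h v hv
    obtain ⟨x, y⟩ := v
    simp only at hv
    by_cases hx : x = 0
    · simpa [hx, hu₂, hβ₂] using hv
    by_cases hy : y = 0
    · simpa [hy, hu₁, hβ₁] using hv
    have hσx : σ x ≠ 0 := by simpa using hx
    refine (h ⟨y / (x * u₁), by positivity, ?_⟩).elim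
    simp only [map_div₀, map_mul, hu₁s]
    field_simp
    linear_combination hv
end
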